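/- For every integer k ≥ 2, lim_{n→∞} R_n · n^{3/2} · η_k^n = √(ψ_k(η_k))/(8·η_k·√π); that is, R_n is asymptotically equivalent to (√(ψ_k(η_k))/(8·η_k·√π))·n^{−3/2}·η_k^{−n} as n → ∞. -/

import Mathlib

open Filter Set

/-- Regular expressions over an alphabet `A` (grammar β := ε | σ | β+β | β·β | β⋆). -/
inductive RegEx (A : Type) : Type where
  | eps : RegEx A
  | char (a : A) : RegEx A
  | plus (l r : RegEx A) : RegEx A
  | cat (l r : RegEx A) : RegEx A
  | star (e : RegEx A) : RegEx A

namespace RegEx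

/-- The (tree-)size of an expression: number of symbols / syntax-tree nodes. -/
def size {A : Type} : RegEx A → ℕ
  | eps => 1
  | char _ => 1
  | plus l r => size l + size r + 1
  | cat l r => size l + size r + 1
  | star e => size e + 1

/-- The number of letter occurrences (alphabetic size). -/
def letters {A : Type} : RegEx A → ℕ
  | eps => 0
  | char _ => 1
  | plus l r => letters l + letters r
  | cat l r => letters l + letters r
  | star e => letters e

/-- `IsUnionOfLetters e l` : `e` is a binary union tree whose leaves are single letters,
read from left to right giving the list `l`. -/
inductive IsUnionOfLetters {A : Type} : RegEx A → List A → Prop where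
  | char (a : A) : IsUnionOfLetters (char a) [a]
  | plus {l r : RegEx A} {ll rl : List A} :
      IsUnionOfLetters l ll → IsUnionOfLetters r rl →
      IsUnionOfLetters (plus l r) (ll ++ rl)

/-- `e` is of the form `(σ_{i₁}+⋯+σ_{i_k})⋆` where `σ_{i₁},…,σ_{i_k}` is a permutation of
the (finite) alphabet `A`. -/
def IsSigmaStar {A : Type} [Fintype A] (e : RegEx A) : Prop :=
  ∃ (f : RegEx A) (l : List A),
    e = star f ∧ IsUnionOfLetters f l ∧ l.Nodup ∧ ∀ a : A, a ∈ l

/-- The absorbing pattern `Σ⋆` does not occur in `e` as an argument of a union. -/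
def Avoids {A : Type} [Fintype A] : RegEx A → Prop
  | eps => True
  | char _ => True
  | plus l r => Avoids l ∧ Avoids r ∧ ¬ IsSigmaStar l ∧ ¬ IsSigmaStar r
  | cat l r => Avoids l ∧ Avoids r
  | star e => Avoids e

end RegEx

/-- Number of expressions in `REna` (over a `k`-letter alphabet) of size `n`. -/
noncomputable def Rcount (k n : ℕ) : ℕ :=
  Nat.card {e : RegEx (Fin k) // RegEx.Avoids e ∧ RegEx.size e = n}

/-- Number of all regular expressions (over a `k`-letter alphabet) of size `n`. -/
noncomputable def Bcount (k n : ℕ) : ℕ :=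
  Nat.card {e : RegEx (Fin k) // RegEx.size e = n}

/-- Total number of letter occurrences over all expressions in `REna` of size `n`. -/
noncomputable def Lcount (k n : ℕ) : ℕ :=
  Nat.card {p : RegEx (Fin k) × ℕ //
    RegEx.Avoids p.1 ∧ RegEx.size p.1 = n ∧ p.2 < RegEx.letters p.1}

/-- `C_k = (2k-2)!/(k-1)!` as a real number. -/
noncomputable def Cc (k : ℕ) : ℝ :=
  ((2 * k - 2).factorial : ℝ) / ((k - 1).factorial : ℝ)

/-- `p_k(z) = 1 − 2z − (7+8k)z²`. -/
noncomputable def Pp (k : ℕ) (z : ℝ) : ℝ := 1 - 2 * z - (7 + 8 * k) * z ^ 2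

/-- `h_k(z) = 1 − z − C_k·z^{2k+1}`. -/
noncomputable def Hh (k : ℕ) (z : ℝ) : ℝ := 1 - z - Cc k * z ^ (2 * k + 1)

/-- `Δ_k(z) = p_k(z) + 4·C_k·z^{2k+1}·h_k(z)`. -/
noncomputable def Dd (k : ℕ) (z : ℝ) : ℝ :=
  Pp k z + 4 * Cc k * z ^ (2 * k + 1) * Hh k z

/-- `g_k(z) = 2 − C_k·z^{2k−1}·(h_k(z) − C_k·z^{2k−1})`. -/
noncomputable def Gg (k : ℕ) (z : ℝ) : ℝ :=
  2 - Cc k * z ^ (2 * k - 1) * (Hh k z - Cc k * z ^ (2 * k - 1))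

/-- `ρ_k = 1/(1+√(8+8k))`, the positive root of `p_k`. -/
noncomputable def rho (k : ℕ) : ℝ := 1 / (1 + Real.sqrt (8 + 8 * k))

/-- `ψ_k(x) = −x·Δ_k′(x)`. -/
noncomputable def psi (k : ℕ) (x : ℝ) : ℝ := -x * deriv (Dd k) x

/-- `η` is a root of `Δ_k` in the interval `(0, 1/√(8+8k))`, and is the unique such root. -/
def IsEta (k : ℕ) (η : ℝ) : Prop :=
  η ∈ Set.Ioo (0 : ℝ) (1 / Real.sqrt (8 + 8 * k)) ∧ Dd k η = 0 ∧
    ∀ x ∈ Set.Ioo (0 : ℝ) (1 / Real.sqrt (8 + 8 * k)), Dd k x = 0 → x = η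

theorem tendsto_pow_mul_sum_antidiagonal {α β : ℕ → ℂ} {L : ℂ}
    (hα : Tendsto (fun n : ℕ => (((n : ℝ) ^ ((3 : ℝ) / 2) : ℝ) : ℂ) * α n) atTop (nhds L))
    (hβ : Summable fun j : ℕ => ((j : ℝ) + 1) ^ 2 * ‖β j‖) :
    Tendsto (fun n : ℕ => (((n : ℝ) ^ ((3 : ℝ) / 2) : ℝ) : ℂ) *
      ∑ p ∈ Finset.HasAntidiagonal.antidiagonal n, β p.1 * α p.2) atTop (nhds (L * ∑' j, β j)) := by
  have hratio : ∀ j : ℕ, Tendsto (fun n : ℕ => ((n + j : ℕ) : ℝ) ^ ((3 : ℝ) / 2) /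
      (n : ℝ) ^ ((3 : ℝ) / 2)) atTop (nhds 1) := by
    intro j
    have h1 : Tendsto (fun n : ℕ => 1 + (j : ℝ) / (n : ℝ)) atTop (nhds 1) := by
      simpa using (tendsto_const_div_atTop_nhds_zero_nat (j : ℝ)).const_add 1
    have h2 := h1.rpow_const (p := (3 : ℝ) / 2) (Or.inl one_ne_zero)
    rw [Real.one_rpow] at h2
    refine h2.congr' ?_
    filter_upwards [eventually_gt_atTop 0] with n hn
    rw [← Real.div_rpow (by positivity) (by positivity)]
    congr 1
    push_cast
    field_simp
  have hαj : ∀ j : ℕ, Tendsto (fun n : ℕ => (((n : ℝ) ^ ((3 : ℝ) / 2) : ℝ) : ℂ) * α (n - j))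
      atTop (nhds L) := by
    intro j
    rw [← tendsto_add_atTop_iff_nat j]
    have h := (Complex.continuous_ofReal.tendsto 1 |>.comp (hratio j)).mul hα
    rw [Complex.ofReal_one, one_mul] at h
    refine h.congr' ?_
    filter_upwards [eventually_gt_atTop 0] with n hn
    have : (n : ℝ) ^ ((3 : ℝ) / 2) ≠ 0 := by positivity
    simp only [Function.comp, Nat.add_sub_cancel]
    rw [← mul_assoc, ← Complex.ofReal_mul, div_mul_cancel₀ _ this]
  obtain ⟨M, hM⟩ : ∃ M : ℝ, ∀ n : ℕ, ((n : ℝ) + 1) ^ ((3 : ℝ) / 2) * ‖α n‖ ≤ M := by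
    have h := (Complex.continuous_ofReal.tendsto 1 |>.comp (hratio 1)).mul hα
    have h' : Tendsto (fun n : ℕ => ((n : ℝ) + 1) ^ ((3 : ℝ) / 2) * ‖α n‖) atTop
        (nhds ‖(1 : ℂ) * L‖) := by
      refine h.norm.congr' ?_
      filter_upwards [eventually_gt_atTop 0] with n hn
      have h0 : (n : ℝ) ^ ((3 : ℝ) / 2) ≠ 0 := by positivity
      simp only [Function.comp]
      rw [← mul_assoc, ← Complex.ofReal_mul, div_mul_cancel₀ _ h0, norm_mul,
        Complex.norm_real, Real.norm_of_nonneg (by positivity)]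
      push_cast
      rfl
    obtain ⟨M, hM⟩ := h'.bddAbove_range
    exact ⟨M, fun n => hM ⟨n, rfl⟩⟩
  have hsum : ∀ n : ℕ, (((n : ℝ) ^ ((3 : ℝ) / 2) : ℝ) : ℂ) *
      ∑ p ∈ Finset.HasAntidiagonal.antidiagonal n, β p.1 * α p.2 =
      ∑' j, if j ≤ n then (((n : ℝ) ^ ((3 : ℝ) / 2) : ℝ) : ℂ) * α (n - j) * β j else 0 := by
    intro n
    rw [tsum_eq_sum (s := Finset.range (n + 1)) (fun j hj => if_neg (by
      simpa [Nat.lt_succ_iff] using hj)),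
      Finset.Nat.sum_antidiagonal_eq_sum_range_succ (fun i j => β i * α j), Finset.mul_sum]
    refine Finset.sum_congr rfl fun j hj => ?_
    rw [if_pos (by simpa [Nat.lt_succ_iff] using hj)]
    ring
  simp only [hsum]
  rw [← tsum_mul_left]
  refine tendsto_tsum_of_dominated_convergence (hβ.mul_left M) (fun j => ?_)
    (Eventually.of_forall fun n j => ?_)
  · refine ((hαj j).mul_const (β j)).congr' ?_
    filter_upwards [eventually_ge_atTop j] with n hn
    rw [if_pos hn]
  · split_ifs with hjn
    · rw [norm_mul, norm_mul, Complex.norm_real, Real.norm_of_nonneg (by positivity)]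
      have h1 : (n : ℝ) ≤ (((n - j : ℕ) : ℝ) + 1) * ((j : ℝ) + 1) := by
        have : n ≤ (n - j + 1) * (j + 1) := by
          obtain ⟨m, rfl⟩ := Nat.exists_eq_add_of_le hjn
          rw [Nat.add_sub_cancel_left]
          nlinarith
        exact_mod_cast this
      have h2 : (n : ℝ) ^ ((3 : ℝ) / 2) ≤
          (((n - j : ℕ) : ℝ) + 1) ^ ((3 : ℝ) / 2) * ((j : ℝ) + 1) ^ 2 := by
        calc (n : ℝ) ^ ((3 : ℝ) / 2) ≤ ((((n - j : ℕ) : ℝ) + 1) * ((j : ℝ) + 1)) ^ ((3 : ℝ) / 2) :=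
              Real.rpow_le_rpow (by positivity) h1 (by norm_num)
          _ = (((n - j : ℕ) : ℝ) + 1) ^ ((3 : ℝ) / 2) * ((j : ℝ) + 1) ^ ((3 : ℝ) / 2) :=
              Real.mul_rpow (by positivity) (by positivity)
          _ ≤ _ := by
              gcongr
              rw [← Real.rpow_natCast]
              refine Real.rpow_le_rpow_of_exponent_le ?_ (by norm_num)
              have : (0 : ℝ) ≤ j := by positivity
              linarith
      calc (n : ℝ) ^ ((3 : ℝ) / 2) * ‖α (n - j)‖ * ‖β j‖
          ≤ (((n - j : ℕ) : ℝ) + 1) ^ ((3 : ℝ) / 2) * ((j : ℝ) + 1) ^ 2 * ‖α (n - j)‖ * ‖β j‖ := by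
            gcongr
        _ = ((((n - j : ℕ) : ℝ) + 1) ^ ((3 : ℝ) / 2) * ‖α (n - j)‖) *
              (((j : ℝ) + 1) ^ 2 * ‖β j‖) := by ring
        _ ≤ _ := by
            gcongr
            exact hM (n - j)
    · rw [norm_zero]
      have hM0 : 0 ≤ M := le_trans (by positivity) (hM 0)
      positivity

theorem tendsto_sqrt_mul_centralBinom :
    Tendsto (fun n : ℕ => √(n : ℝ) * n.centralBinom / 4 ^ n) atTop (nhds (√Real.pi)⁻¹) := by
  have h1 := Stirling.tendsto_stirlingSeq_sqrt_pi
  have h2 : Tendsto (fun n : ℕ => Stirling.stirlingSeq (2 * n)) atTop (nhds √Real.pi) :=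
    h1.comp (tendsto_id.const_mul_atTop' (by norm_num))
  have hpi : √Real.pi ≠ 0 := by positivity
  have h3 := h2.div (h1.pow 2) (pow_ne_zero 2 hpi)
  have : √Real.pi / √Real.pi ^ 2 = (√Real.pi)⁻¹ := by field_simp
  rw [this] at h3
  refine h3.congr' ?_
  filter_upwards [eventually_gt_atTop 0] with n hn
  have hn' : (0 : ℝ) < n := by positivity
  have hc : (n.centralBinom : ℝ) = (2 * n).factorial / (n.factorial : ℝ) ^ 2 := by
    rw [Nat.centralBinom_eq_two_mul_choose, Nat.cast_choose ℝ (by omega)]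
    rw [show 2 * n - n = n by omega, sq]
  simp only [Stirling.stirlingSeq, Pi.div_apply, hc]
  have e1 : √(2 * ((2 * n : ℕ) : ℝ)) = 2 * √(n : ℝ) := by
    rw [show (2 * ((2 * n : ℕ) : ℝ)) = 2 ^ 2 * n by push_cast; ring,
      Real.sqrt_mul (by positivity), Real.sqrt_sq (by norm_num)]
  have e2 : √(2 * (n : ℝ)) ^ 2 = 2 * n := Real.sq_sqrt (by positivity)
  have e3 : √(n : ℝ) ^ 2 = n := Real.sq_sqrt (by positivity)
  have hs : √(n : ℝ) ≠ 0 := by positivity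
  rw [e1]
  simp only [div_pow, mul_pow, e2, pow_mul]
  push_cast
  rw [show (4 : ℝ) = 2 ^ 2 by norm_num]
  field_simp
  rw [e3]
  ring

theorem tendsto_rpow_mul_catalan :
    Tendsto (fun n : ℕ => (n : ℝ) ^ ((3 : ℝ) / 2) * ((catalan n : ℝ) / 4 ^ n)) atTop
      (nhds (√Real.pi)⁻¹) := by
  have h := tendsto_sqrt_mul_centralBinom.mul (tendsto_natCast_div_add_atTop (1 : ℝ))
  rw [mul_one] at h
  refine h.congr' ?_
  filter_upwards [eventually_gt_atTop 0] with n hn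
  have hn' : (0 : ℝ) < n := by positivity
  have hc : ((n : ℝ) + 1) * catalan n = n.centralBinom := by
    exact_mod_cast succ_mul_catalan_eq_centralBinom n
  rw [show (3 : ℝ) / 2 = 1 / 2 + 1 by norm_num, Real.rpow_add hn', Real.rpow_one,
    ← Real.sqrt_eq_rpow, ← hc]
  field_simp

/-- The coefficients of `√(1 - z)`. -/
noncomputable def sqrtCoeff : ℕ → ℂ
  | 0 => 1
  | n + 1 => -2 * catalan n / 4 ^ (n + 1)

theorem tendsto_rpow_mul_sqrtCoeff :
    Tendsto (fun n : ℕ => (((n : ℝ) ^ ((3 : ℝ) / 2) : ℝ) : ℂ) * sqrtCoeff n) atTop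
      (nhds (-(2 * √Real.pi : ℝ)⁻¹ : ℂ)) := by
  rw [← tendsto_add_atTop_iff_nat 1]
  have h1 : Tendsto (fun n : ℕ => (1 + 1 / (n : ℝ)) ^ ((3 : ℝ) / 2)) atTop (nhds 1) := by
    have h : Tendsto (fun n : ℕ => 1 + 1 / (n : ℝ)) atTop (nhds 1) := by
      simpa using (tendsto_const_div_atTop_nhds_zero_nat (1 : ℝ)).const_add 1
    simpa using h.rpow_const (p := (3 : ℝ) / 2) (Or.inl one_ne_zero)
  have h2 := (h1.mul tendsto_rpow_mul_catalan).const_mul (-1 / 2)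
  have h3 := (Complex.continuous_ofReal.tendsto _).comp h2
  rw [show -1 / 2 * (1 * (√Real.pi)⁻¹) = -(2 * √Real.pi)⁻¹ by rw [mul_inv]; ring,
    Complex.ofReal_neg] at h3
  refine (h3.congr' ?_).trans (by push_cast; rfl)
  filter_upwards [eventually_gt_atTop 0] with n hn
  have hn' : (0 : ℝ) < n := by positivity
  have e : ((n + 1 : ℕ) : ℝ) ^ ((3 : ℝ) / 2) =
      (1 + 1 / (n : ℝ)) ^ ((3 : ℝ) / 2) * (n : ℝ) ^ ((3 : ℝ) / 2) := by
    rw [← Real.mul_rpow (by positivity) (by positivity)]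
    congr 1
    push_cast
    field_simp
  simp only [Function.comp, e, sqrtCoeff]
  push_cast
  rw [pow_succ]
  ring

open PowerSeries in
theorem mk_sqrtCoeff_sq : (PowerSeries.mk sqrtCoeff) ^ 2 = 1 - (X : PowerSeries ℂ) := by
  set c : PowerSeries ℂ := PowerSeries.map (Nat.castRingHom ℂ) catalanSeries with hc
  have h1 : c ^ 2 * X + 1 = c := by
    have := congrArg (PowerSeries.map (Nat.castRingHom ℂ)) catalanSeries_sq_mul_X_add_one
    simpa [hc] using this
  have h2 : PowerSeries.mk sqrtCoeff =
      PowerSeries.rescale (1 / 4 : ℂ) (1 - 2 * X * c) := by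
    ext n
    rw [coeff_mk, coeff_rescale]
    rcases n with _ | n
    · simp [sqrtCoeff]
    · rw [show (1 - 2 * X * c) = 1 - X * (PowerSeries.C 2 * c) by
        rw [show (PowerSeries.C (2 : ℂ)) = 2 from map_ofNat _ 2]; ring, map_sub,
        coeff_succ_X_mul, coeff_C_mul]
      simp [sqrtCoeff, hc, coeff_one]
      ring
  rw [h2, ← map_pow, show (1 - 2 * X * c) ^ 2 = 1 - 4 * X by linear_combination (4 * X) * h1]
  ext n
  rw [coeff_rescale]
  rcases n with _ | _ | n
  · simp
  · rw [show (4 : PowerSeries ℂ) = PowerSeries.C 4 from (map_ofNat _ 4).symm]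
    simp [coeff_one, coeff_X]
  · rw [show (4 : PowerSeries ℂ) = PowerSeries.C 4 from (map_ofNat _ 4).symm]
    simp [coeff_one, coeff_X]

theorem PowerSeries.eq_of_hasSum {F G : PowerSeries ℂ} {f : ℂ → ℂ} {r : ℝ} (hr : 0 < r)
    (hF : ∀ z : ℂ, ‖z‖ < r → HasSum (fun n => coeff n F * z ^ n) (f z))
    (hG : ∀ z : ℂ, ‖z‖ < r → HasSum (fun n => coeff n G * z ^ n) (f z)) : F = G := by
  have key : ∀ H : PowerSeries ℂ, (∀ z : ℂ, ‖z‖ < r → HasSum (fun n => coeff n H * z ^ n) (f z)) →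
      HasFPowerSeriesAt f (FormalMultilinearSeries.ofScalars ℂ fun n => coeff n H) 0 := by
    intro H hH
    rw [hasFPowerSeriesAt_iff]
    filter_upwards [Metric.ball_mem_nhds (0 : ℂ) hr] with z hz
    rw [zero_add]
    have e : (fun n => z ^ n • (FormalMultilinearSeries.ofScalars ℂ fun n => coeff n H).coeff n) =
        fun n => coeff n H * z ^ n := by
      funext n
      simp [FormalMultilinearSeries.coeff_ofScalars, mul_comm]
    rw [e]
    exact hH z (by simpa using hz)
  have h := (key F hF).eq_formalMultilinearSeries (key G hG)
  ext n
  have := congrArg (fun p => FormalMultilinearSeries.coeff p n) h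
  simpa using this

theorem PowerSeries.exists_sqrt_of_re_pos (Q : Polynomial ℂ) {s r : ℝ} (hs : 0 < s) (hsr : s < r)
    (hQ : ∀ z : ℂ, ‖z‖ ≤ r → 0 < (Q.eval z).re) :
    ∃ b : PowerSeries ℂ, b ^ 2 = (Q : PowerSeries ℂ) ∧
      constantCoeff b = (Q.eval 0) ^ (1 / 2 : ℂ) ∧
      (Summable fun j : ℕ => ((j : ℝ) + 1) ^ 2 * ‖coeff j b * (s : ℂ) ^ j‖) ∧
      ∑' j : ℕ, coeff j b * (s : ℂ) ^ j = (Q.eval (s : ℂ)) ^ (1 / 2 : ℂ) := by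
  have hr : 0 < r := hs.trans hsr
  lift r to NNReal using hr.le
  set f : ℂ → ℂ := fun z => (Q.eval z) ^ (1 / 2 : ℂ) with hf
  have hd : DifferentiableOn ℂ f (Metric.closedBall 0 r) := by
    intro z hz
    refine DifferentiableAt.differentiableWithinAt ?_
    exact (Q.differentiable z).cpow_const (Or.inl (hQ z (by simpa using hz)))
  have hp := hd.hasFPowerSeriesOnBall (by exact_mod_cast hr)
  set p := cauchyPowerSeries f 0 r
  let b : PowerSeries ℂ := PowerSeries.mk fun n => p.coeff n
  have hsum : ∀ z : ℂ, ‖z‖ < r → HasSum (fun n => coeff n b * z ^ n) (f z) := by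
    intro z hz
    have h := hp.hasSum (y := z) (by
      rw [Metric.eball_coe]
      simpa using hz)
    simpa [b, mul_comm] using h
  have hnorm : ∀ z : ℂ, ‖z‖ < r → Summable fun n => ‖coeff n b * z ^ n‖ := fun z hz =>
    (hsum z hz).summable.norm
  refine ⟨b, ?_, ?_, ?_, (hsum s (by simpa [abs_of_pos hs] using hsr)).tsum_eq⟩
  · refine eq_of_hasSum (f := fun z => Q.eval z) hr (fun z hz => ?_) fun z _ => ?_
    · have h1 := tsum_mul_tsum_eq_tsum_sum_antidiagonal_of_summable_norm (hnorm z hz) (hnorm z hz)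
      have h2 := (summable_norm_sum_mul_antidiagonal_of_summable_norm
        (hnorm z hz) (hnorm z hz)).of_norm.hasSum
      rw [← h1, (hsum z hz).tsum_eq] at h2
      have h3 : f z * f z = Q.eval z := by
        rw [← sq, hf]
        simp
      rw [h3] at h2
      have e : (fun n => coeff n (b ^ 2) * z ^ n) = fun n =>
          ∑ x ∈ Finset.HasAntidiagonal.antidiagonal n,
            coeff x.1 b * z ^ x.1 * (coeff x.2 b * z ^ x.2) := by
        funext n
        rw [sq, coeff_mul, Finset.sum_mul]
        refine Finset.sum_congr rfl fun x hx => ?_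
        rw [← Finset.HasAntidiagonal.mem_antidiagonal.1 hx, pow_add]
        ring
      rw [e]
      exact h2
    · have := hasSum_sum_of_ne_finset_zero (L := SummationFilter.unconditional ℕ)
        (f := fun n => coeff n (Q : PowerSeries ℂ) * z ^ n)
        (s := Finset.range (Q.natDegree + 1)) (fun n hn => by
          rw [Polynomial.coeff_coe, Q.coeff_eq_zero_of_natDegree_lt (by
            simpa [Nat.lt_succ_iff] using hn), zero_mul])
      rw [Polynomial.eval_eq_sum_range]
      simp only [Polynomial.coeff_coe] at this ⊢
      exact this
  · have h := (hsum 0 (by simpa using hr)).unique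
      (hasSum_single (f := fun n => coeff n b * 0 ^ n) 0 fun n hn => by simp [hn])
    simpa [hf] using h.symm
  · obtain ⟨q, hq1, hq2⟩ := exists_between hsr
    have hq0 := hs.trans hq1
    have hqn : ‖(q : ℂ)‖ < r := by
      rw [Complex.norm_real, Real.norm_of_nonneg hq0.le]
      exact hq2
    obtain ⟨M, hM⟩ := (hnorm q hqn).tendsto_atTop_zero.bddAbove_range
    have hx : ‖s / q‖ < 1 := by
      rw [Real.norm_of_nonneg (by positivity), div_lt_one hq0]
      exact hq1
    have h0 : Summable fun n : ℕ => (n : ℝ) ^ 2 * (s / q) ^ n :=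
      summable_pow_mul_geometric_of_norm_lt_one 2 hx
    have h1 : Summable fun n : ℕ => ((n + 1 : ℕ) : ℝ) ^ 2 * (s / q) ^ (n + 1) :=
      (summable_nat_add_iff 1).2 h0
    refine Summable.of_nonneg_of_le (fun j => by positivity) (fun j => ?_)
      (h1.mul_left (M * (q / s)))
    have hj : ‖coeff j b * (q : ℂ) ^ j‖ ≤ M := hM ⟨j, rfl⟩
    rw [norm_mul, norm_pow, Complex.norm_real, Real.norm_of_nonneg hq0.le] at hj
    rw [norm_mul, norm_pow, Complex.norm_real, Real.norm_of_nonneg hs.le]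
    calc ((j : ℝ) + 1) ^ 2 * (‖coeff j b‖ * s ^ j)
        = ((j : ℝ) + 1) ^ 2 * (s / q) ^ j * (‖coeff j b‖ * q ^ j) := by
          rw [div_pow]; field_simp
      _ ≤ ((j : ℝ) + 1) ^ 2 * (s / q) ^ j * M := by gcongr
      _ = _ := by
          push_cast
          rw [pow_succ (s / q)]
          field_simp

open Polynomial in
/-- The quotient of `X ^ n - y ^ n` by `X - y`. -/
noncomputable def powQuot (n : ℕ) (y : ℂ) : Polynomial ℂ :=
  ∑ i ∈ Finset.range n, X ^ i * C y ^ (n - 1 - i)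

open Polynomial in
theorem powQuot_mul (n : ℕ) (y : ℂ) : powQuot n y * (X - C y) = X ^ n - C y ^ n :=
  (Commute.all X (C y)).geom_sum₂_mul n

theorem norm_eval_powQuot_le {n : ℕ} {y z : ℂ} {r : ℝ} (hy : ‖y‖ ≤ r) (hz : ‖z‖ ≤ r) :
    ‖(powQuot n y).eval z‖ ≤ n * r ^ (n - 1) := by
  have hr : 0 ≤ r := (norm_nonneg y).trans hy
  rw [powQuot, Polynomial.eval_finsetSum]
  have hcard : ∑ i ∈ Finset.range n, r ^ (n - 1) = n * r ^ (n - 1) := by simp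
  rw [← hcard]
  refine norm_sum_le_of_le (Finset.range n) fun i hi => ?_
  have hi' : n - 1 = i + (n - 1 - i) := by
    have := Finset.mem_range.1 hi
    omega
  rw [hi', pow_add, ← hi']
  simp only [Polynomial.eval_mul, Polynomial.eval_pow, Polynomial.eval_X, Polynomial.eval_C,
    norm_mul, norm_pow]
  gcongr

theorem eval_powQuot_self (n : ℕ) (y : ℂ) : (powQuot n y).eval y = n * y ^ (n - 1) := by
  rw [powQuot, Polynomial.eval_finsetSum]
  rw [Finset.sum_congr rfl (g := fun _ => y ^ (n - 1)) fun i hi => ?_]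
  · simp
  · simp only [Polynomial.eval_mul, Polynomial.eval_pow, Polynomial.eval_X, Polynomial.eval_C]
    rw [← pow_add]
    congr 1
    have := Finset.mem_range.1 hi
    omega

open Polynomial in
/-- `Δ_k` as a complex polynomial. -/
noncomputable def deltaPoly (k : ℕ) : Polynomial ℂ :=
  1 - 2 * X - (7 + 8 * (k : Polynomial ℂ)) * X ^ 2 +
    4 * C (Cc k : ℂ) * X ^ (2 * k + 1) * (1 - X - C (Cc k : ℂ) * X ^ (2 * k + 1))

open Polynomial in
/-- The quotient of `Δ_k` by `1 - X / y`, when `y` is a root of `Δ_k`. -/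
noncomputable def deltaQuot (k : ℕ) (y : ℂ) : Polynomial ℂ :=
  C y * (2 + (7 + 8 * (k : Polynomial ℂ)) * (X + C y) - 4 * C (Cc k : ℂ) * (powQuot (2 * k + 1) y -
    powQuot (2 * k + 2) y - C (Cc k : ℂ) * powQuot (4 * k + 2) y))

theorem eval_deltaPoly_ofReal (k : ℕ) (x : ℝ) : (deltaPoly k).eval (x : ℂ) = (Dd k x : ℂ) := by
  simp [deltaPoly, Dd, Pp, Hh]

open Polynomial in
theorem deltaPoly_eq_mul_deltaQuot {k : ℕ} {y : ℂ} (hy0 : y ≠ 0) (hy : (deltaPoly k).eval y = 0) :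
    deltaPoly k = (1 - C y⁻¹ * X) * deltaQuot k y := by
  have hc : C y⁻¹ * C y = 1 := by rw [← C_mul, inv_mul_cancel₀ hy0, C_1]
  have h0 : (1 - 2 * C y - (7 + 8 * k) * C y ^ 2 + 4 * C (Cc k : ℂ) * C y ^ (2 * k + 1) *
      (1 - C y - C (Cc k : ℂ) * C y ^ (2 * k + 1)) : Polynomial ℂ) = 0 := by
    have := congrArg C hy
    have h2 : (C 2 : Polynomial ℂ) = 2 := map_ofNat C 2
    have h4 : (C 4 : Polynomial ℂ) = 4 := map_ofNat C 4
    have h7 : (C 7 : Polynomial ℂ) = 7 := map_ofNat C 7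
    have h8 : (C 8 : Polynomial ℂ) = 8 := map_ofNat C 8
    simpa [deltaPoly, h2, h4, h7, h8] using this
  have h1 := powQuot_mul (2 * k + 1) y
  have h2 := powQuot_mul (2 * k + 2) y
  have h3 := powQuot_mul (4 * k + 2) y
  have e2 : ∀ x : Polynomial ℂ, x ^ (2 * k + 2) = x ^ (2 * k + 1) * x := fun x => by ring
  have e3 : ∀ x : Polynomial ℂ, x ^ (4 * k + 2) = x ^ (2 * k + 1) * x ^ (2 * k + 1) :=
    fun x => by ring
  rw [e2, e2] at h2
  rw [e3, e3] at h3
  have hfac : (1 - C y⁻¹ * X) * C y = -(X - C y) := by linear_combination (-X) * hc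
  rw [deltaQuot, ← mul_assoc, hfac, deltaPoly]
  linear_combination (-4 * C (Cc k : ℂ)) * h1 + 4 * C (Cc k : ℂ) * h2 +
    4 * C (Cc k : ℂ) ^ 2 * h3 + h0

theorem eval_deltaQuot_self (k : ℕ) (x : ℝ) : (deltaQuot k x).eval (x : ℂ) = (psi k x : ℂ) := by
  have h : HasDerivAt (Dd k) (-2 - (7 + 8 * k) * (2 * x) + 4 * Cc k *
      ((2 * k + 1) * x ^ (2 * k) * (1 - x - Cc k * x ^ (2 * k + 1)) +
        x ^ (2 * k + 1) * (-1 - Cc k * ((2 * k + 1) * x ^ (2 * k))))) x := by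
    have hp : HasDerivAt (fun z : ℝ => z ^ (2 * k + 1)) ((2 * k + 1) * x ^ (2 * k)) x := by
      simpa using hasDerivAt_pow (2 * k + 1) x
    have hp2 : HasDerivAt (fun z : ℝ => z ^ 2) (2 * x) x := by
      simpa using hasDerivAt_pow 2 x
    have hi := hasDerivAt_id' x
    have hH : HasDerivAt (Hh k) (-1 - Cc k * ((2 * k + 1) * x ^ (2 * k))) x := by
      change HasDerivAt (fun z : ℝ => 1 - z - Cc k * z ^ (2 * k + 1)) _ x
      simpa using (hi.const_sub 1).fun_sub (hp.const_mul (Cc k))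
    have hP : HasDerivAt (Pp k) (-2 - (7 + 8 * k) * (2 * x)) x := by
      change HasDerivAt (fun z : ℝ => 1 - 2 * z - (7 + 8 * k) * z ^ 2) _ x
      simpa using ((hi.const_mul 2).const_sub 1).fun_sub (hp2.const_mul (7 + 8 * k : ℝ))
    have h := hP.add ((hp.const_mul (4 * Cc k)).mul hH)
    refine HasDerivAt.congr_deriv h ?_
    rw [Hh]
    ring
  rw [psi, h.deriv]
  simp only [deltaQuot, Polynomial.eval_mul, Polynomial.eval_add, Polynomial.eval_sub,
    Polynomial.eval_C, Polynomial.eval_X, eval_powQuot_self, Polynomial.eval_natCast,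
    Polynomial.eval_ofNat]
  rw [show 4 * k + 2 - 1 = 2 * k + (2 * k + 1) by omega, pow_add]
  push_cast
  ring

theorem Cc_nonneg (k : ℕ) : 0 ≤ Cc k := by unfold Cc; positivity

theorem Cc_mul_pow_le {k : ℕ} (hk : 2 ≤ k) : Cc k * (1 / (8 * k + 8 : ℝ)) ^ k ≤
    1 / (8 * k + 8) / 4 := by
  obtain ⟨m, rfl⟩ : ∃ m, k = m + 1 := ⟨k - 1, by omega⟩
  have hC : Cc (m + 1) ≤ (2 * m : ℝ) ^ m := by
    have h1 : (2 * (m + 1) - 2).factorial = m.factorial * (m + 1).ascFactorial m := by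
      rw [Nat.factorial_mul_ascFactorial]
      congr 1
      omega
    have h2 : (m + 1).ascFactorial m ≤ (m + m) ^ m := Nat.ascFactorial_le_pow_add m m
    rw [Cc, h1, Nat.add_sub_cancel, Nat.cast_mul, mul_div_cancel_left₀ _ (by positivity), two_mul]
    exact_mod_cast h2
  have h2 : (2 * m : ℝ) * (1 / (8 * (m + 1 : ℕ) + 8)) ≤ 1 / 4 := by
    push_cast
    rw [mul_one_div, div_le_div_iff₀ (by positivity) (by norm_num)]
    linarith
  calc Cc (m + 1) * (1 / (8 * (m + 1 : ℕ) + 8 : ℝ)) ^ (m + 1)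
      ≤ (2 * m : ℝ) ^ m * (1 / (8 * (m + 1 : ℕ) + 8 : ℝ)) ^ (m + 1) := by gcongr
    _ = ((2 * m : ℝ) * (1 / (8 * (m + 1 : ℕ) + 8))) ^ m * (1 / (8 * (m + 1 : ℕ) + 8)) := by
        rw [mul_pow, pow_succ]; ring
    _ ≤ (1 / 4) ^ m * (1 / (8 * (m + 1 : ℕ) + 8)) := by gcongr
    _ ≤ (1 / 4) ^ 1 * (1 / (8 * (m + 1 : ℕ) + 8)) := by
        refine mul_le_mul_of_nonneg_right ?_ (by positivity)
        exact pow_le_pow_of_le_one (by norm_num) (by norm_num) (by omega)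
    _ = _ := by ring

theorem exists_re_deltaQuot_pos {k : ℕ} (hk : 2 ≤ k) {η : ℝ}
    (hη : η ∈ Ioo (0 : ℝ) (1 / √(8 + 8 * k))) :
    ∃ r > η, ∀ z : ℂ, ‖z‖ ≤ r → 0 < ((deltaQuot k η).eval z).re := by
  obtain ⟨h0, h1⟩ := hη
  set a : ℝ := 1 / √(8 + 8 * k) with ha
  have ha2 : a ^ 2 = 1 / (8 * k + 8) := by
    rw [ha, div_pow, Real.sq_sqrt (by positivity), one_pow, add_comm]
  have ha0 : 0 < a := by positivity
  have hk' : (2 : ℝ) ≤ k := by exact_mod_cast hk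
  set t : ℝ := 1 / (8 * k + 8) with ht
  have ht0 : 0 < t := by positivity
  have htk : t * (8 * k + 8) = 1 := by rw [ht]; field_simp
  have ha1 : a ≤ 1 := by
    have : t ≤ 1 := by nlinarith
    nlinarith
  have hC0 := Cc_nonneg k
  have hCa : Cc k * a ^ (2 * k) ≤ t / 4 := by
    rw [pow_mul, ha2]
    exact Cc_mul_pow_le hk
  refine ⟨min a (η + 1 / (4 * (7 + 8 * k))), lt_min h1 (by simp; positivity), fun z hz => ?_⟩
  have hza : ‖z‖ ≤ a := hz.trans (min_le_left _ _)
  have hzr : ‖z‖ ≤ η + 1 / (4 * (7 + 8 * k)) := hz.trans (min_le_right _ _)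
  have hηa : ‖(η : ℂ)‖ ≤ a := by
    rw [Complex.norm_real, Real.norm_of_nonneg h0.le]
    exact h1.le
  set p := (powQuot (2 * k + 1) η).eval z - (powQuot (2 * k + 2) η).eval z -
    (Cc k : ℂ) * (powQuot (4 * k + 2) η).eval z with hp
  have e : (deltaQuot k η).eval z = η * (2 + ((7 + 8 * k : ℝ) : ℂ) * (z + η) -
      ((4 * Cc k : ℝ) : ℂ) * p) := by
    simp [deltaQuot, hp]
  have hpn : ‖p‖ ≤ (2 * k + 1) * a ^ (2 * k) + (2 * k + 2) * a ^ (2 * k + 1) +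
      Cc k * ((4 * k + 2) * a ^ (4 * k + 1)) := by
    have b1 := norm_eval_powQuot_le (n := 2 * k + 1) hηa hza
    have b2 := norm_eval_powQuot_le (n := 2 * k + 2) hηa hza
    have b3 := norm_eval_powQuot_le (n := 4 * k + 2) hηa hza
    push_cast at b1 b2 b3
    refine (norm_sub_le _ _).trans (add_le_add ((norm_sub_le _ _).trans (add_le_add b1 b2)) ?_)
    rw [norm_mul, Complex.norm_real, Real.norm_of_nonneg hC0]
    gcongr
  have hCp : 4 * Cc k * ‖p‖ ≤ 1 := by
    set u := Cc k * a ^ (2 * k) with hu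
    have hu0 : 0 ≤ u := by positivity
    have hua : u * a ≤ u := mul_le_of_le_one_right hu0 ha1
    have hk0 : (0 : ℝ) < k := by linarith
    calc 4 * Cc k * ‖p‖ ≤ 4 * Cc k * ((2 * k + 1) * a ^ (2 * k) + (2 * k + 2) * a ^ (2 * k + 1) +
          Cc k * ((4 * k + 2) * a ^ (4 * k + 1))) := by gcongr
      _ = 4 * ((2 * k + 1) * u + (2 * k + 2) * (u * a) + (4 * k + 2) * (u * (u * a))) := by
        rw [hu, show 4 * k + 1 = 2 * k + 2 * k + 1 by ring]
        ring
      _ ≤ 4 * ((2 * k + 1) * u + (2 * k + 2) * u + (4 * k + 2) * (u * u)) := by gcongr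
      _ ≤ 4 * ((2 * k + 1) * (t / 4) + (2 * k + 2) * (t / 4) + (4 * k + 2) * ((t / 4) * (t / 4))) := by
        gcongr
      _ ≤ 1 := by nlinarith
  have hre1 : ‖(((4 * Cc k : ℝ) : ℂ) * p)‖ ≤ 1 := by
    rw [norm_mul, Complex.norm_real, Real.norm_of_nonneg (by positivity)]
    exact hCp
  have hre2 := (Complex.re_le_norm _).trans hre1
  have hz' := (abs_le.1 (Complex.abs_re_le_norm z)).1
  have h7 : (7 + 8 * k : ℝ) * (z.re + η) ≥ -(1 / 4) := by
    have : z.re + η ≥ -(1 / (4 * (7 + 8 * k))) := by linarith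
    calc (7 + 8 * k : ℝ) * (z.re + η) ≥ (7 + 8 * k) * -(1 / (4 * (7 + 8 * k))) := by gcongr
      _ = -(1 / 4) := by field_simp
  rw [e, Complex.re_ofReal_mul]
  refine mul_pos h0 ?_
  rw [Complex.sub_re, Complex.add_re, Complex.re_ofReal_mul, Complex.add_re, Complex.ofReal_re]
  simp only [Complex.re_ofNat]
  linarith

namespace RegEx

variable {A : Type}

/-- Decomposition of an expression along its root symbol. -/
def rootEquiv (A : Type) : RegEx A ≃
    Unit ⊕ A ⊕ RegEx A ⊕ (RegEx A × RegEx A) ⊕ (RegEx A × RegEx A) where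
  toFun
    | eps => .inl ()
    | char a => .inr (.inl a)
    | star e => .inr (.inr (.inl e))
    | plus l r => .inr (.inr (.inr (.inl (l, r))))
    | cat l r => .inr (.inr (.inr (.inr (l, r))))
  invFun
    | .inl _ => eps
    | .inr (.inl a) => char a
    | .inr (.inr (.inl e)) => star e
    | .inr (.inr (.inr (.inl q))) => plus q.1 q.2
    | .inr (.inr (.inr (.inr q))) => cat q.1 q.2
  left_inv e := by cases e <;> rfl
  right_inv x := by rcases x with _ | _ | _ | _ | _ <;> rfl

theorem card_subtype_eq_add (p : RegEx A → Prop) [Finite {e // p e}] :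
    Nat.card {e // p e} = Nat.card {_u : Unit // p eps} + (Nat.card {a // p (char a)} +
      (Nat.card {e // p (star e)} + (Nat.card {q : RegEx A × RegEx A // p (plus q.1 q.2)} +
        Nat.card {q : RegEx A × RegEx A // p (cat q.1 q.2)}))) := by
  let E : {e // p e} ≃ {_u : Unit // p eps} ⊕ {a // p (char a)} ⊕ {e // p (star e)} ⊕
      {q : RegEx A × RegEx A // p (plus q.1 q.2)} ⊕ {q : RegEx A × RegEx A // p (cat q.1 q.2)} :=
    ((rootEquiv A).symm.subtypeEquivOfSubtype (p := p)).symm.trans <|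
      (Equiv.subtypeSum).trans <| Equiv.sumCongr (Equiv.refl _) <|
      (Equiv.subtypeSum).trans <| Equiv.sumCongr (Equiv.refl _) <|
      (Equiv.subtypeSum).trans <| Equiv.sumCongr (Equiv.refl _) Equiv.subtypeSum
  have h0 := Finite.of_equiv _ E
  have h1 := @Finite.sum_right _ _ h0
  have h2 := @Finite.sum_right _ _ h1
  have h3 := @Finite.sum_right _ _ h2
  have h2' := @Finite.sum_left _ _ h1
  have h3' := @Finite.sum_left _ _ h2
  have h4' := @Finite.sum_left _ _ h3
  have h4 := @Finite.sum_right _ _ h3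
  have h1' := @Finite.sum_left _ _ h0
  rw [Nat.card_congr E, Nat.card_sum, Nat.card_sum, Nat.card_sum, Nat.card_sum]

theorem size_pos (e : RegEx A) : 0 < e.size := by cases e <;> simp [size]

theorem finite_setOf_size_le [Finite A] (n : ℕ) : {e : RegEx A | e.size ≤ n}.Finite := by
  induction n with
  | zero =>
    refine Set.finite_empty.subset fun e he => ?_
    have := e.size_pos
    simp only [Set.mem_ofPred_eq] at he
    omega
  | succ n ih =>
    refine ((((Set.finite_singleton eps).union (Set.finite_range char)).union
      (ih.image star)).union ((ih.image2 plus ih).union (ih.image2 cat ih))).subset fun e he => ?_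
    cases e with
    | eps => simp
    | char a => simp
    | star e =>
      simp only [Set.mem_ofPred_eq, size] at he
      exact Or.inl (Or.inr ⟨e, by simp only [Set.mem_ofPred_eq]; omega, rfl⟩)
    | plus l r =>
      simp only [Set.mem_ofPred_eq, size] at he
      exact Or.inr (Or.inl ⟨l, by simp only [Set.mem_ofPred_eq]; omega, r,
        by simp only [Set.mem_ofPred_eq]; omega, rfl⟩)
    | cat l r =>
      simp only [Set.mem_ofPred_eq, size] at he
      exact Or.inr (Or.inr ⟨l, by simp only [Set.mem_ofPred_eq]; omega, r,
        by simp only [Set.mem_ofPred_eq]; omega, rfl⟩)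

theorem finite_subtype_of_size_le [Finite A] {p : RegEx A → Prop} (n : ℕ)
    (h : ∀ e, p e → e.size ≤ n) : Finite {e // p e} :=
  ((finite_setOf_size_le n).subset h).to_subtype

instance [Finite A] (p : RegEx A → Prop) (n : ℕ) : Finite {e // p e ∧ e.size = n} :=
  finite_subtype_of_size_le n fun _ h => h.2.le

theorem card_pairs_size_eq [Finite A] (P : RegEx A → Prop) (n : ℕ) :
    Nat.card {q : RegEx A × RegEx A // (P q.1 ∧ P q.2) ∧ q.1.size + q.2.size = n} =
      ∑ x ∈ Finset.HasAntidiagonal.antidiagonal n,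
        Nat.card {e // P e ∧ e.size = x.1} * Nat.card {e // P e ∧ e.size = x.2} := by
  let g : {q : RegEx A × RegEx A // (P q.1 ∧ P q.2) ∧ q.1.size + q.2.size = n} →
      {x // x ∈ Finset.HasAntidiagonal.antidiagonal n} := fun q =>
    ⟨(q.1.1.size, q.1.2.size), Finset.HasAntidiagonal.mem_antidiagonal.2 q.2.2⟩
  let E : ∀ x : {x // x ∈ Finset.HasAntidiagonal.antidiagonal n}, {q // g q = x} ≃
      {e // P e ∧ e.size = x.1.1} × {e // P e ∧ e.size = x.1.2} := fun x =>
    { toFun := fun q =>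
        (⟨q.1.1.1, q.1.2.1.1, congrArg (fun y => y.1.1) q.2⟩,
          ⟨q.1.1.2, q.1.2.1.2, congrArg (fun y => y.1.2) q.2⟩)
      invFun := fun q => ⟨⟨(q.1.1, q.2.1), ⟨q.1.2.1, q.2.2.1⟩, by
        rw [q.1.2.2, q.2.2.2]
        exact Finset.HasAntidiagonal.mem_antidiagonal.1 x.2⟩,
        Subtype.ext (Prod.ext q.1.2.2 q.2.2.2)⟩
      left_inv := fun _ => rfl
      right_inv := fun _ => rfl }
  rw [← Nat.card_congr (Equiv.sigmaFiberEquiv g), Nat.card_congr (Equiv.sigmaCongrRight E),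
    Nat.card_sigma]
  simp only [Nat.card_prod]
  exact Finset.sum_coe_sort (Finset.HasAntidiagonal.antidiagonal n) fun x =>
    Nat.card {e // P e ∧ e.size = x.1} * Nat.card {e // P e ∧ e.size = x.2}

namespace IsUnionOfLetters

variable {e : RegEx A} {l : List A}

theorem length_pos (h : IsUnionOfLetters e l) : 0 < l.length := by
  induction h with
  | char a => simp
  | plus _ _ ih _ => simp; omega

theorem letters_eq (h : IsUnionOfLetters e l) : e.letters = l.length := by
  induction h with
  | char a => rfl
  | plus _ _ ih1 ih2 => simp [letters, ih1, ih2]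

theorem size_add_one (h : IsUnionOfLetters e l) : e.size + 1 = 2 * l.length := by
  induction h with
  | char a => rfl
  | plus _ _ ih1 ih2 => simp [size]; omega

theorem unique (h : IsUnionOfLetters e l) {l' : List A} (h' : IsUnionOfLetters e l') : l = l' := by
  induction h generalizing l' with
  | char a => cases h'; rfl
  | plus _ _ ih1 ih2 =>
    cases h' with
    | plus h1 h2 => rw [ih1 h1, ih2 h2]

theorem avoids [Fintype A] (h : IsUnionOfLetters e l) : e.Avoids := by
  have aux : ∀ {e : RegEx A} {l : List A}, IsUnionOfLetters e l → ¬ IsSigmaStar e := by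
    rintro e l h ⟨f, l', rfl, -⟩
    cases h
  induction h with
  | char a => trivial
  | plus h1 h2 ih1 ih2 => exact ⟨ih1, ih2, aux h1, aux h2⟩

end IsUnionOfLetters

theorem finite_isUnionOfLetters [Finite A] (l : List A) :
    Finite {e : RegEx A // IsUnionOfLetters e l} :=
  finite_subtype_of_size_le (2 * l.length) fun e h => by
    have := h.size_add_one
    omega

theorem isUnionOfLetters_plus_iff {p q : RegEx A} {l : List A} :
    IsUnionOfLetters (plus p q) l ↔
      IsUnionOfLetters p (l.take p.letters) ∧ IsUnionOfLetters q (l.drop p.letters) := by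
  constructor
  · intro h
    cases h with
    | plus h1 h2 =>
      rw [h1.letters_eq, List.take_left, List.drop_left]
      exact ⟨h1, h2⟩
  · rintro ⟨h1, h2⟩
    have := h1.plus h2
    rwa [List.take_append_drop] at this

theorem card_isUnionOfLetters [Finite A] (n : ℕ) (l : List A) (hl : l.length = n + 1) :
    Nat.card {e : RegEx A // IsUnionOfLetters e l} = catalan n := by
  induction n using Nat.strong_induction_on generalizing l with
  | _ n ih =>
    have hfin := finite_isUnionOfLetters l
    rw [card_subtype_eq_add]
    have h0 : Nat.card {_u : Unit // IsUnionOfLetters (eps : RegEx A) l} = 0 := by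
      have : IsEmpty {_u : Unit // IsUnionOfLetters (eps : RegEx A) l} := ⟨fun x => by cases x.2⟩
      exact Nat.card_of_isEmpty
    have h1 : Nat.card {e : RegEx A // IsUnionOfLetters (star e) l} = 0 := by
      have : IsEmpty {e : RegEx A // IsUnionOfLetters (star e) l} := ⟨fun x => by cases x.2⟩
      exact Nat.card_of_isEmpty
    have h2 : Nat.card {q : RegEx A × RegEx A // IsUnionOfLetters (cat q.1 q.2) l} = 0 := by
      have : IsEmpty {q : RegEx A × RegEx A // IsUnionOfLetters (cat q.1 q.2) l} :=
        ⟨fun x => by cases x.2⟩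
      exact Nat.card_of_isEmpty
    rw [h0, h1, h2]
    rcases n with _ | n
    · obtain ⟨a, rfl⟩ := List.length_eq_one_iff.1 hl
      have h3 : Nat.card {q : RegEx A × RegEx A // IsUnionOfLetters (plus q.1 q.2) [a]} = 0 := by
        have : IsEmpty {q : RegEx A × RegEx A // IsUnionOfLetters (plus q.1 q.2) [a]} :=
          ⟨fun x => by
            have h := isUnionOfLetters_plus_iff.1 x.2
            have h1 := h.1.length_pos
            have h2 := h.2.length_pos
            simp at h1 h2
            omega⟩
        exact Nat.card_of_isEmpty
      have h4 : Nat.card {b : A // IsUnionOfLetters (char b) [a]} = 1 := by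
        rw [Nat.card_eq_one_iff_unique]
        refine ⟨⟨fun x y => Subtype.ext ?_⟩, ⟨⟨a, .char a⟩⟩⟩
        have hx := x.2.unique (.char x.1)
        have hy := y.2.unique (.char y.1)
        simpa using hx.symm.trans hy
      rw [h3, h4, catalan_zero]
    · have h3 : Nat.card {b : A // IsUnionOfLetters (char b) l} = 0 := by
        have : IsEmpty {b : A // IsUnionOfLetters (char b) l} := ⟨fun x => by
          rw [x.2.unique (.char x.1)] at hl
          simp at hl⟩
        exact Nat.card_of_isEmpty
      let g : {q : RegEx A × RegEx A // IsUnionOfLetters (plus q.1 q.2) l} → Fin (n + 1) :=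
        fun q => ⟨q.1.1.letters - 1, by
          have h := isUnionOfLetters_plus_iff.1 q.2
          have h1 := h.1.length_pos
          have h2 := h.2.length_pos
          simp at h1 h2
          omega⟩
      have hg : ∀ q, (g q : ℕ) + 1 = q.1.1.letters := fun q => by
        have h1 := (isUnionOfLetters_plus_iff.1 q.2).1.length_pos
        simp at h1
        change q.1.1.letters - 1 + 1 = _
        omega
      let E : ∀ i : Fin (n + 1), {q // g q = i} ≃
          {e : RegEx A // IsUnionOfLetters e (l.take (i + 1))} ×
            {e : RegEx A // IsUnionOfLetters e (l.drop (i + 1))} := fun i =>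
        have hi : ∀ q : {q // g q = i}, (i : ℕ) + 1 = q.1.1.1.letters := fun q => by
          rw [← hg, q.2]
        { toFun := fun q =>
            (⟨q.1.1.1, by
                rw [hi q]
                exact (isUnionOfLetters_plus_iff.1 q.1.2).1⟩,
              ⟨q.1.1.2, by
                rw [hi q]
                exact (isUnionOfLetters_plus_iff.1 q.1.2).2⟩)
          invFun := fun q => ⟨⟨(q.1.1, q.2.1), by
              have := q.1.2.plus q.2.2
              rwa [List.take_append_drop] at this⟩, Fin.ext (by
              have h := q.1.2.letters_eq
              rw [List.length_take, min_eq_left (by have := i.2; omega)] at h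
              change q.1.1.letters - 1 = i
              omega)⟩
          left_inv := fun _ => rfl
          right_inv := fun _ => rfl }
      have (i : Fin (n + 1)) : Finite {q // g q = i} := by
        have := finite_isUnionOfLetters (l.take (i + 1))
        have := finite_isUnionOfLetters (l.drop (i + 1))
        exact Finite.of_equiv _ (E i).symm
      rw [h3, ← Nat.card_congr (Equiv.sigmaFiberEquiv g), Nat.card_sigma, catalan_succ]
      simp only [zero_add, add_zero]
      refine Finset.sum_congr rfl fun i _ => ?_
      have hi := i.2
      rw [Nat.card_congr (E i), Nat.card_prod, ih i (by omega) _ (by simp; omega),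
        ih (n - i) (by omega) _ (by simp; omega)]

theorem card_nodup_complete_lists [Fintype A] :
    Nat.card {l : List A // l.Nodup ∧ ∀ a, a ∈ l} = (Fintype.card A).factorial := by
  classical
  have h : ∀ l : List A, (l.Nodup ∧ ∀ a, a ∈ l) ↔
      l ∈ (Finset.univ.toList : List A).permutations.toFinset := by
    intro l
    rw [List.mem_toFinset, List.mem_permutations]
    constructor
    · rintro ⟨h1, h2⟩
      rw [List.perm_ext_iff_of_nodup h1 (Finset.nodup_toList _)]
      simp [h2]
    · intro h
      exact ⟨h.nodup_iff.2 (Finset.nodup_toList _), fun a => h.mem_iff.2 (by simp)⟩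
  rw [Nat.card_congr (Equiv.subtypeEquivRight h), Nat.card_eq_fintype_card, Fintype.card_coe,
    List.toFinset_card_of_nodup (List.nodup_permutations _ (Finset.nodup_toList _)),
    List.length_permutations, Finset.length_toList, Finset.card_univ]

section IsSigmaStar

variable [Fintype A]

theorem IsSigmaStar.avoids {e : RegEx A} (h : IsSigmaStar e) : e.Avoids := by
  obtain ⟨f, l, rfl, hf, -⟩ := h
  change f.Avoids
  exact hf.avoids

theorem length_of_nodup_complete {l : List A} (h : l.Nodup ∧ ∀ a, a ∈ l) :
    l.length = Fintype.card A := by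
  classical
  rw [← List.toFinset_card_of_nodup h.1, ← Finset.card_univ]
  congr 1
  ext a
  simp [h.2]

theorem IsSigmaStar.size_eq {e : RegEx A} (h : IsSigmaStar e) : e.size = 2 * Fintype.card A := by
  obtain ⟨f, l, rfl, hf, hl⟩ := h
  rw [size, hf.size_add_one, length_of_nodup_complete hl]

theorem card_isSigmaStar [Nonempty A] :
    Nat.card {e : RegEx A // IsSigmaStar e} =
      (Fintype.card A).factorial * catalan (Fintype.card A - 1) := by
  let g : (Σ l : {l : List A // l.Nodup ∧ ∀ a, a ∈ l}, {e : RegEx A // IsUnionOfLetters e l.1}) →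
      {e : RegEx A // IsSigmaStar e} := fun x => ⟨star x.2.1, x.2.1, x.1.1, rfl, x.2.2, x.1.2⟩
  have hg : Function.Bijective g := by
    constructor
    · rintro ⟨⟨l, hl⟩, ⟨e, he⟩⟩ ⟨⟨l', hl'⟩, ⟨e', he'⟩⟩ h
      have : e = e' := star.inj (congrArg Subtype.val h)
      subst this
      have := he.unique he'
      subst this
      rfl
    · rintro ⟨_, f, l, rfl, hf, hl⟩
      exact ⟨⟨⟨l, hl⟩, ⟨f, hf⟩⟩, rfl⟩
  have hfin : Finite {l : List A // l.Nodup ∧ ∀ a, a ∈ l} :=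
    Nat.finite_of_card_ne_zero (by
      rw [card_nodup_complete_lists]
      exact (Fintype.card A).factorial_ne_zero)
  have := Fintype.ofFinite {l : List A // l.Nodup ∧ ∀ a, a ∈ l}
  have := fun l : List A => finite_isUnionOfLetters l
  rw [← Nat.card_congr (Equiv.ofBijective g hg), Nat.card_sigma,
    Finset.sum_congr rfl fun l _ => card_isUnionOfLetters (Fintype.card A - 1) l.1 (by
      have := Fintype.card_pos (α := A)
      rw [length_of_nodup_complete l.2]
      omega)]
  rw [Finset.sum_const, smul_eq_mul, Finset.card_univ, ← Nat.card_eq_fintype_card,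
    card_nodup_complete_lists]

theorem card_avoids_not_isSigmaStar (n : ℕ) :
    Nat.card {e : RegEx A // (Avoids e ∧ ¬ IsSigmaStar e) ∧ e.size = n} +
      Nat.card {e : RegEx A // IsSigmaStar e ∧ e.size = n} =
      Nat.card {e : RegEx A // Avoids e ∧ e.size = n} := by
  classical
  rw [← Nat.card_congr (Equiv.sumCompl fun e : {e : RegEx A // Avoids e ∧ e.size = n} =>
    IsSigmaStar e.1), Nat.card_sum, add_comm]
  congr 1
  · refine Nat.card_congr (((Equiv.subtypeSubtypeEquivSubtypeInter _ _).trans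
      (Equiv.subtypeEquivRight fun e => ?_)).symm)
    exact ⟨fun h => ⟨h.2, h.1.2⟩, fun h => ⟨⟨h.1.avoids, h.2⟩, h.1⟩⟩
  · refine Nat.card_congr (((Equiv.subtypeSubtypeEquivSubtypeInter _
      fun e : RegEx A => ¬ IsSigmaStar e).trans (Equiv.subtypeEquivRight fun e => ?_)).symm)
    tauto

theorem card_isSigmaStar_size_eq [Nonempty A] (n : ℕ) :
    Nat.card {e : RegEx A // IsSigmaStar e ∧ e.size = n} = if n = 2 * Fintype.card A then
      (Fintype.card A).factorial * catalan (Fintype.card A - 1) else 0 := by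
  split_ifs with h
  · rw [← card_isSigmaStar]
    exact Nat.card_congr (Equiv.subtypeEquivRight fun e =>
      ⟨fun h => h.1, fun he => ⟨he, he.size_eq.trans h.symm⟩⟩)
  · have : IsEmpty {e : RegEx A // IsSigmaStar e ∧ e.size = n} :=
      ⟨fun e => h (e.2.2.symm.trans e.2.1.size_eq)⟩
    exact Nat.card_of_isEmpty

theorem card_avoids_size_zero : Nat.card {e : RegEx A // Avoids e ∧ e.size = 0} = 0 := by
  have : IsEmpty {e : RegEx A // Avoids e ∧ e.size = 0} := ⟨fun e => e.1.size_pos.ne' e.2.2⟩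
  exact Nat.card_of_isEmpty

theorem card_avoids_size_succ (n : ℕ) :
    Nat.card {e : RegEx A // Avoids e ∧ e.size = n + 1} =
      (if n = 0 then 1 + Fintype.card A else 0) + Nat.card {e : RegEx A // Avoids e ∧ e.size = n} +
      ∑ x ∈ Finset.HasAntidiagonal.antidiagonal n,
        Nat.card {e : RegEx A // (Avoids e ∧ ¬ IsSigmaStar e) ∧ e.size = x.1} *
          Nat.card {e : RegEx A // (Avoids e ∧ ¬ IsSigmaStar e) ∧ e.size = x.2} +
      ∑ x ∈ Finset.HasAntidiagonal.antidiagonal n,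
        Nat.card {e : RegEx A // Avoids e ∧ e.size = x.1} *
          Nat.card {e : RegEx A // Avoids e ∧ e.size = x.2} := by
  rw [card_subtype_eq_add, ← card_pairs_size_eq, ← card_pairs_size_eq]
  have h1 : Nat.card {e : RegEx A // Avoids (star e) ∧ (star e).size = n + 1} =
      Nat.card {e : RegEx A // Avoids e ∧ e.size = n} :=
    Nat.card_congr (Equiv.subtypeEquivRight fun e => by simp [Avoids, size])
  have h2 : Nat.card {q : RegEx A × RegEx A // Avoids (plus q.1 q.2) ∧
      (plus q.1 q.2).size = n + 1} = Nat.card {q : RegEx A × RegEx A //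
        ((Avoids q.1 ∧ ¬ IsSigmaStar q.1) ∧ (Avoids q.2 ∧ ¬ IsSigmaStar q.2)) ∧
          q.1.size + q.2.size = n} :=
    Nat.card_congr (Equiv.subtypeEquivRight fun q => by simp [Avoids, size]; tauto)
  have h3 : Nat.card {q : RegEx A × RegEx A // Avoids (cat q.1 q.2) ∧
      (cat q.1 q.2).size = n + 1} = Nat.card {q : RegEx A × RegEx A //
        (Avoids q.1 ∧ Avoids q.2) ∧ q.1.size + q.2.size = n} :=
    Nat.card_congr (Equiv.subtypeEquivRight fun q => by simp [Avoids, size])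
  have h4 : Nat.card {_u : Unit // Avoids (eps : RegEx A) ∧ (eps : RegEx A).size = n + 1} +
      Nat.card {a : A // Avoids (char a) ∧ (char a).size = n + 1} =
        if n = 0 then 1 + Fintype.card A else 0 := by
    split_ifs with h
    · subst h
      simp [Avoids, size]
    · simp [Avoids, size, h]
  rw [h1, h2, h3, ← h4]
  ring

end IsSigmaStar

end RegEx

theorem Cc_eq_factorial_mul_catalan {k : ℕ} (hk : 1 ≤ k) :
    Cc k = (k.factorial * catalan (k - 1) : ℕ) := by
  obtain ⟨m, rfl⟩ : ∃ m, k = m + 1 := ⟨k - 1, by omega⟩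
  have h1 := succ_mul_catalan_eq_centralBinom m
  have h2 : m.centralBinom * m.factorial * m.factorial = (2 * m).factorial := by
    have := Nat.choose_mul_factorial_mul_factorial (n := 2 * m) (k := m) (by omega)
    rwa [show 2 * m - m = m by omega] at this
  rw [Cc, show 2 * (m + 1) - 2 = 2 * m by omega, Nat.add_sub_cancel, ← h2, ← h1,
    Nat.factorial_succ]
  push_cast
  field_simp

/-- The generating function of `Rcount k`. -/
noncomputable def countSeries (k : ℕ) : PowerSeries ℂ := PowerSeries.mk fun n => (Rcount k n : ℂ)

open PowerSeries in
theorem countSeries_eq {k : ℕ} (hk : 1 ≤ k) :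
    countSeries k = X * (1 + (k : PowerSeries ℂ) + countSeries k +
      (countSeries k - C (Cc k : ℂ) * X ^ (2 * k)) ^ 2 + countSeries k ^ 2) := by
  have : Nonempty (Fin k) := ⟨⟨0, hk⟩⟩
  have hsub : countSeries k - C (Cc k : ℂ) * X ^ (2 * k) = PowerSeries.mk fun n => (Nat.card
      {e : RegEx (Fin k) // (RegEx.Avoids e ∧ ¬ RegEx.IsSigmaStar e) ∧ e.size = n} : ℂ) := by
    ext n
    have h := RegEx.card_avoids_not_isSigmaStar (A := Fin k) n
    rw [RegEx.card_isSigmaStar_size_eq, Fintype.card_fin] at h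
    rw [map_sub, countSeries, coeff_mk, coeff_mk, coeff_C_mul, coeff_X_pow, Rcount, ← h,
      Cc_eq_factorial_mul_catalan hk]
    split_ifs <;> simp
  ext n
  rcases n with _ | n
  · rw [coeff_zero_X_mul, countSeries, coeff_mk, Rcount, RegEx.card_avoids_size_zero, Nat.cast_zero]
  · rw [coeff_succ_X_mul, hsub, countSeries, coeff_mk, Rcount, RegEx.card_avoids_size_succ]
    simp only [sq, map_add, coeff_mul, coeff_mk, Rcount, Fintype.card_fin, coeff_one,
      ← map_natCast (C (R := ℂ)), coeff_C]
    push_cast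
    split_ifs <;> ring

open PowerSeries in
theorem sqrt_countSeries_sq {k : ℕ} (hk : 1 ≤ k) :
    (1 - X + 2 * C (Cc k : ℂ) * X ^ (2 * k + 1) - 4 * X * countSeries k) ^ 2 =
      (deltaPoly k : PowerSeries ℂ) := by
  have e : (deltaPoly k : PowerSeries ℂ) = 1 - 2 * X - (7 + 8 * (k : PowerSeries ℂ)) * X ^ 2 +
      4 * C (Cc k : ℂ) * X ^ (2 * k + 1) * (1 - X - C (Cc k : ℂ) * X ^ (2 * k + 1)) := by
    have hn : ∀ n : ℕ, ((n : Polynomial ℂ) : PowerSeries ℂ) = n := fun n =>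
      map_natCast (Polynomial.coeToPowerSeries.ringHom (R := ℂ)) n
    have h2 : ((2 : Polynomial ℂ) : PowerSeries ℂ) = 2 := hn 2
    have h4 : ((4 : Polynomial ℂ) : PowerSeries ℂ) = 4 := hn 4
    have h7 : ((7 : Polynomial ℂ) : PowerSeries ℂ) = 7 := hn 7
    have h8 : ((8 : Polynomial ℂ) : PowerSeries ℂ) = 8 := hn 8
    simp [deltaPoly, hn, h2, h4, h7, h8]
  rw [e]
  linear_combination (-8 * X) * countSeries_eq hk

open PowerSeries in
theorem tendsto_coeff_of_sq_eq_deltaPoly {k : ℕ} (hk : 2 ≤ k) {η : ℝ}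
    (hη : η ∈ Ioo (0 : ℝ) (1 / √(8 + 8 * k))) (h0 : Dd k η = 0) {F : PowerSeries ℂ}
    (hF : F ^ 2 = (deltaPoly k : PowerSeries ℂ)) (hF0 : constantCoeff F = 1) :
    Tendsto (fun n : ℕ => (((n : ℝ) ^ ((3 : ℝ) / 2) : ℝ) : ℂ) * (coeff n F * (η : ℂ) ^ n)) atTop
      (nhds (-(2 * √Real.pi : ℝ)⁻¹ * (√(psi k η) : ℝ) : ℂ)) := by
  have hη0 : (η : ℂ) ≠ 0 := Complex.ofReal_ne_zero.2 hη.1.ne'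
  obtain ⟨r, hr, hre⟩ := exists_re_deltaQuot_pos hk hη
  obtain ⟨b, hb2, hb0, hbs, hbt⟩ := exists_sqrt_of_re_pos (deltaQuot k η) hη.1 hr hre
  have hfac := deltaPoly_eq_mul_deltaQuot hη0 (by rw [eval_deltaPoly_ofReal, h0, Complex.ofReal_zero])
  have hb0' : constantCoeff b = 1 := by
    have := congrArg (Polynomial.eval 0) hfac
    simp [deltaPoly] at this
    rw [hb0, ← this, Complex.one_cpow]
  set a : PowerSeries ℂ := rescale (η : ℂ)⁻¹ (PowerSeries.mk sqrtCoeff) with ha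
  have ha2 : a ^ 2 = 1 - C (η : ℂ)⁻¹ * X := by
    rw [ha, ← map_pow, mk_sqrtCoeff_sq, map_sub, map_one, rescale_X]
  have ha0 : constantCoeff a = 1 := by
    rw [← coeff_zero_eq_constantCoeff_apply, ha, coeff_rescale, coeff_mk]
    simp [sqrtCoeff]
  have hab : F = b * a := by
    have hsq : F ^ 2 = (b * a) ^ 2 := by
      rw [hF, mul_pow, hb2, ha2, hfac, Polynomial.coe_mul, Polynomial.coe_sub, Polynomial.coe_one,
        Polynomial.coe_mul, Polynomial.coe_C, Polynomial.coe_X, mul_comm]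
    refine (sq_eq_sq_iff_eq_or_eq_neg.1 hsq).resolve_right fun h => ?_
    have := congrArg constantCoeff h
    rw [map_neg, map_mul, hF0, hb0', ha0] at this
    norm_num at this
  have hlim := tendsto_pow_mul_sum_antidiagonal tendsto_rpow_mul_sqrtCoeff hbs
  have hpsi : (deltaQuot k η).eval (η : ℂ) ^ (1 / 2 : ℂ) = (√(psi k η) : ℝ) := by
    have hpos := hre η (by
      rw [Complex.norm_real, Real.norm_of_nonneg hη.1.le]
      exact hr.le)
    rw [eval_deltaQuot_self, Complex.ofReal_re] at hpos
    rw [eval_deltaQuot_self, Real.sqrt_eq_rpow, Complex.ofReal_cpow hpos.le]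
    norm_num
  rw [hbt, hpsi] at hlim
  refine hlim.congr fun n => ?_
  congr 1
  rw [hab, coeff_mul, Finset.sum_mul]
  refine Finset.sum_congr rfl fun x hx => ?_
  rw [← Finset.HasAntidiagonal.mem_antidiagonal.1 hx, pow_add, ha, coeff_rescale, coeff_mk,
    inv_pow]
  field_simp

/-- For every integer `k ≥ 2`,
`lim_{n→∞} R_n·n^{3/2}·η_k^n = √(ψ_k(η_k))/(8·η_k·√π)`, i.e. `R_n` is asymptotically
equivalent to `(√(ψ_k(η_k))/(8·η_k·√π))·n^{−3/2}·η_k^{−n}` as `n → ∞`. -/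
theorem statement13 (k : ℕ) (hk : 2 ≤ k) (η : ℝ) (hη : IsEta k η) :
    Tendsto (fun n : ℕ => (Rcount k n : ℝ) * (n : ℝ) ^ ((3 : ℝ) / 2) * η ^ n)
      atTop (nhds (Real.sqrt (psi k η) / (8 * η * Real.sqrt Real.pi))) := by
  have hη0 : (0 : ℝ) < η := hη.1.1
  set F : PowerSeries ℂ := 1 - PowerSeries.X +
    2 * PowerSeries.C (Cc k : ℂ) * PowerSeries.X ^ (2 * k + 1) -
      4 * PowerSeries.X * countSeries k with hF
  have hlim := tendsto_coeff_of_sq_eq_deltaPoly hk hη.1 hη.2.1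
    (sqrt_countSeries_sq (by omega)) (by simp)
  rw [← hF, ← tendsto_add_atTop_iff_nat 1] at hlim
  have hcoeff : ∀ n : ℕ, 2 * k < n → PowerSeries.coeff (n + 1) F = -4 * Rcount k n := by
    intro n hn
    have e : F = 1 - PowerSeries.X + PowerSeries.C (2 * Cc k : ℂ) * PowerSeries.X ^ (2 * k + 1) -
        PowerSeries.X * (PowerSeries.C 4 * countSeries k) := by
      rw [hF, map_mul, map_ofNat, map_ofNat]
      ring
    rw [e, map_sub, map_add, map_sub, PowerSeries.coeff_succ_X_mul, PowerSeries.coeff_C_mul,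
      PowerSeries.coeff_C_mul, PowerSeries.coeff_X_pow, PowerSeries.coeff_one, PowerSeries.coeff_X,
      if_neg (by omega), if_neg (by omega), if_neg (by omega), countSeries, PowerSeries.coeff_mk]
    ring
  have hratio : Tendsto (fun n : ℕ => ((n : ℝ) / (n + 1)) ^ ((3 : ℝ) / 2)) atTop (nhds 1) := by
    simpa using (tendsto_natCast_div_add_atTop (1 : ℝ)).rpow_const (p := (3 : ℝ) / 2)
      (Or.inl one_ne_zero)
  have hre := ((Complex.continuous_re.tendsto _).comp hlim).mul hratio |>.const_mul (-1 / (4 * η))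
  have hval : -1 / (4 * η) * ((-(2 * √Real.pi : ℝ)⁻¹ * (√(psi k η) : ℝ) : ℂ).re * 1) =
      √(psi k η) / (8 * η * √Real.pi) := by
    rw [← Complex.ofReal_neg, ← Complex.ofReal_mul, Complex.ofReal_re]
    field_simp
    ring
  rw [hval] at hre
  refine hre.congr' ?_
  filter_upwards [eventually_gt_atTop (2 * k)] with n hn
  have e1 : (((n + 1 : ℕ) : ℝ) ^ ((3 : ℝ) / 2) : ℝ) * ((n : ℝ) / (n + 1)) ^ ((3 : ℝ) / 2) =
      (n : ℝ) ^ ((3 : ℝ) / 2) := by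
    rw [← Real.mul_rpow (by positivity) (by positivity)]
    congr 1
    push_cast
    field_simp
  have e2 : (-4 * (Rcount k n : ℂ) * (η : ℂ) ^ (n + 1)) =
      ((-4 * Rcount k n * η ^ (n + 1) : ℝ) : ℂ) := by push_cast; ring
  simp only [Function.comp]
  rw [hcoeff n hn, e2, ← Complex.ofReal_mul, Complex.ofReal_re, ← e1, pow_succ]
  field_simp
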